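/- arXiv:1708.00064 — 2 statements merged into one kernel-verified Lean document; each statement's English description precedes it below -/
import Mathlib

section
/- Let n ≥ 3 and let C_n denote the cycle graph on vertices {1,…,n}. For any list of distinct real numbers λ₁ < λ₂ < ⋯ < λ_{n−1} and any integer k with 1 ≤ k ≤ n−1, there exists a matrix A ∈ S(C_n) with the Strong Spectral Property such that the eigenvalue λ_k of A has multiplicity 2 and each λ_i with i ≠ k is a simple eigenvalue of A (and A has no other eigenvalues). -/
open Matrix

/-- The geometric multiplicity of `lam` as an eigenvalue of `A`:
`dim ker (A - lam • I)`. -/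
noncomputable def multOf {m : Type*} [Fintype m] [DecidableEq m]
    (A : Matrix m m ℝ) (lam : ℝ) : ℕ :=
  Module.finrank ℝ (LinearMap.ker (A - lam • (1 : Matrix m m ℝ)).mulVecLin)

/-- The Strong Spectral Property. -/
def HasSSP {m : Type*} [Fintype m] [DecidableEq m] (A : Matrix m m ℝ) : Prop :=
  ∀ X : Matrix m m ℝ, X.IsSymm → Matrix.hadamard A X = 0 →
    Matrix.hadamard (1 : Matrix m m ℝ) X = 0 → A * X - X * A = 0 → X = 0

/-- `A ∈ S(G)`: `A` is symmetric and its off-diagonal nonzero pattern is given by `G`. -/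
def InS {m : Type*} [Fintype m] [DecidableEq m]
    (G : SimpleGraph m) (A : Matrix m m ℝ) : Prop :=
  A.IsSymm ∧ ∀ i j, i ≠ j → (A i j ≠ 0 ↔ G.Adj i j)


/-- The cycle graph `Cₙ` on vertices `{0, …, n-1}`, with `i` adjacent to
`i + 1 (mod n)`. -/
def cycleG (n : ℕ) : SimpleGraph (Fin n) :=
  SimpleGraph.fromRel fun i j => (i.val + 1) % n = j.val

open Filter Topology

section Multiplicity

variable {m : Type*} [Fintype m] [DecidableEq m]

theorem multOf_eq_finrank_eigenspace (A : Matrix m m ℝ) (t : ℝ) :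
    multOf A t = Module.finrank ℝ (Module.End.eigenspace (Matrix.toLin' A) t) := by
  have h : LinearMap.ker (A - t • (1 : Matrix m m ℝ)).mulVecLin =
      Module.End.eigenspace (Matrix.toLin' A) t := by
    ext v
    simp [sub_eq_zero]
  rw [multOf, h]

theorem sum_multOf_le (A : Matrix m m ℝ) (s : Finset ℝ) :
    ∑ t ∈ s, multOf A t ≤ Fintype.card m := by
  set p := (Matrix.toLin' A).charpoly with hp
  calc ∑ t ∈ s, multOf A t ≤ ∑ t ∈ s, p.roots.count t := by
        refine Finset.sum_le_sum fun t _ => ?_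
        rw [multOf_eq_finrank_eigenspace, Polynomial.count_roots]
        exact LinearMap.finrank_eigenspace_le _ _
    _ ≤ ∑ t ∈ s ∪ p.roots.toFinset, p.roots.count t :=
        Finset.sum_le_sum_of_subset Finset.subset_union_left
    _ = p.roots.card := Multiset.sum_count_eq_card fun t ht =>
        Finset.mem_union_right _ (Multiset.mem_toFinset.2 ht)
    _ ≤ p.natDegree := p.card_roots'
    _ = Fintype.card m := by simp [hp]

theorem multOf_eq_of_le_multOf {A : Matrix m m ℝ} {s : Finset ℝ} {r : ℝ → ℕ}
    (hr : ∀ t ∈ s, r t ≤ multOf A t) (hs : Fintype.card m ≤ ∑ t ∈ s, r t) :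
    (∀ t ∈ s, multOf A t = r t) ∧ ∀ t ∉ s, multOf A t = 0 := by
  have hle := Finset.sum_le_sum hr
  have hsum := sum_multOf_le A s
  refine ⟨fun t ht => ((Finset.sum_eq_sum_iff_of_le hr).1 (by lia) t ht).symm, fun t ht => ?_⟩
  have hins := sum_multOf_le A (insert t s)
  rw [Finset.sum_insert ht] at hins
  lia

theorem one_le_multOf {A : Matrix m m ℝ} {t : ℝ} {v : m → ℝ} (hv : v ≠ 0)
    (hA : A *ᵥ v = t • v) : 1 ≤ multOf A t := by
  rw [multOf_eq_finrank_eigenspace, Nat.one_le_iff_ne_zero, Ne,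
    Submodule.finrank_eq_zero]
  intro h
  have : v ∈ Module.End.eigenspace (Matrix.toLin' A) t := by
    simpa [Module.End.mem_eigenspace_iff] using hA
  exact hv (by simpa [h] using this)

theorem multOf_add_smul_one (A : Matrix m m ℝ) (c t : ℝ) :
    multOf (A + c • (1 : Matrix m m ℝ)) t = multOf A (t - c) := by
  rw [multOf, multOf]
  have h : A + c • (1 : Matrix m m ℝ) - t • 1 = A - (t - c) • 1 := by
    rw [sub_smul]
    abel
  rw [h]

theorem multOf_submatrix {m' : Type*} [Fintype m'] [DecidableEq m'] (A : Matrix m m ℝ)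
    (e : m' ≃ m) (t : ℝ) : multOf (A.submatrix e e) t = multOf A t := by
  have h : A.submatrix e e - t • (1 : Matrix m' m' ℝ) =
      (A - t • (1 : Matrix m m ℝ)).submatrix e e := by
    ext i j
    simp [Matrix.one_apply]
  have key : ∀ B : Matrix m m ℝ, (B.submatrix e e).mulVecLin =
      (LinearEquiv.funCongrLeft ℝ ℝ e).toLinearMap ∘ₗ B.mulVecLin ∘ₗ
        (LinearEquiv.funCongrLeft ℝ ℝ e.symm).toLinearMap := by
    intro B
    refine LinearMap.ext fun v => ?_
    rw [Matrix.mulVecLin_apply, Matrix.submatrix_mulVec_equiv]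
    rfl
  rw [multOf, multOf, h, key, LinearEquiv.ker_comp, LinearMap.ker_comp,
    ← LinearEquiv.funCongrLeft_symm, ← Submodule.map_equiv_eq_comap_symm (LinearEquiv.funCongrLeft ℝ ℝ e), LinearEquiv.finrank_map_eq]

end Multiplicity

section SSP

variable {m : Type*} [Fintype m] [DecidableEq m]

theorem HasSSP.add_smul_one {A : Matrix m m ℝ} (hA : HasSSP A) (c : ℝ) :
    HasSSP (A + c • (1 : Matrix m m ℝ)) := by
  intro X hX h1 h2 h3
  refine hA X hX ?_ h2 ?_
  · rwa [Matrix.add_hadamard, Matrix.smul_hadamard, h2, smul_zero, add_zero] at h1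
  · rw [← h3]
    simp [add_mul, mul_add]

theorem HasSSP.submatrix {m' : Type*} [Fintype m'] [DecidableEq m'] {A : Matrix m m ℝ}
    (hA : HasSSP A) (e : m' ≃ m) : HasSSP (A.submatrix e e) := by
  intro X hX h1 h2 h3
  have hAX : ∀ i j, A (e i) (e j) * X i j = 0 := fun i j => congrFun (congrFun h1 i) j
  have hdiag : ∀ i, X i i = 0 := fun i => by simpa using congrFun (congrFun h2 i) i
  have hXX : (X.submatrix e.symm e.symm).submatrix e e = X := by ext; simp
  have h0 : X.submatrix e.symm e.symm = 0 := by
    refine hA _ (hX.submatrix _) ?_ ?_ ?_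
    · ext i j
      simpa using hAX (e.symm i) (e.symm j)
    · ext i j
      by_cases hij : i = j
      · simp [hij, hdiag]
      · simp [hij]
    · have h4 := congrArg (fun Z => Z.submatrix e.symm e.symm) h3
      simp only [Matrix.submatrix_sub, Pi.sub_apply] at h4
      rw [← Matrix.submatrix_mul_equiv _ _ _ e.symm, ← Matrix.submatrix_mul_equiv _ _ _ e.symm] at h4
      simpa using h4
  rw [← hXX, h0]
  rfl

theorem eventually_commute_eq_zero {d : m → ℝ} {R : m → m → Prop}
    (hR : ∀ i j, i ≠ j → ¬ R i j → d i ≠ d j) :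
    ∀ᶠ A in 𝓝 (Matrix.diagonal d), ∀ X : Matrix m m ℝ, (∀ i, X i i = 0) →
      (∀ i j, R i j → X i j = 0) → A * X = X * A → X = 0 := by
  classical
  rcases isEmpty_or_nonempty m with hm | hm
  · exact Eventually.of_forall fun A X _ _ _ => Subsingleton.elim _ _
  obtain ⟨g, hg0, hg⟩ : ∃ g > 0, ∀ i j, d i ≠ d j → g ≤ |d i - d j| := by
    let f : m × m → ℝ := fun p => if d p.1 = d p.2 then 1 else |d p.1 - d p.2|
    obtain ⟨p, hp⟩ := Finite.exists_min f
    refine ⟨f p, ?_, fun i j hij => ?_⟩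
    · by_cases h : d p.1 = d p.2
      · simp [f, h]
      · simp [f, h, sub_eq_zero]
    · simpa [f, hij] using hp (i, j)
  have hN : (0 : ℝ) < Fintype.card m := by exact_mod_cast Fintype.card_pos
  set δ : ℝ := g / (4 * Fintype.card m) with hδ
  have hδ0 : 0 < δ := by positivity
  have hev : ∀ᶠ A : Matrix m m ℝ in 𝓝 (Matrix.diagonal d), ∀ i j,
      |(A - Matrix.diagonal d) i j| < δ := by
    refine eventually_all.2 fun i => eventually_all.2 fun j => ?_
    have hc : Continuous fun A : Matrix m m ℝ => |(A - Matrix.diagonal d) i j| := by fun_prop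
    refine hc.continuousAt.eventually_lt continuousAt_const ?_
    simpa using hδ0
  filter_upwards [hev] with A hA X hX0 hXR hcomm
  obtain ⟨⟨i, j⟩, hmax⟩ := Finite.exists_max fun p : m × m => |X p.1 p.2|
  suffices h : |X i j| ≤ 0 by
    ext a b
    simpa using (hmax (a, b)).trans h
  by_contra! hpos
  have hXij : X i j ≠ 0 := abs_pos.1 hpos
  have hij : i ≠ j := fun h => hXij (h ▸ hX0 i)
  have hgap := hg i j (hR i j hij fun h => hXij (hXR i j h))
  set E := A - Matrix.diagonal d with hE
  have hAE : A = Matrix.diagonal d + E := by simp [hE]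
  have hentry : (d i - d j) * X i j = ∑ l, (X i l * E l j - E i l * X l j) := by
    have h1 := congrFun (congrFun hcomm i) j
    rw [hAE, add_mul, mul_add, Matrix.add_apply, Matrix.add_apply, Matrix.diagonal_mul,
      Matrix.mul_diagonal, Matrix.mul_apply, Matrix.mul_apply] at h1
    rw [Finset.sum_sub_distrib]
    linarith
  have hbound : |∑ l, (X i l * E l j - E i l * X l j)| ≤
      ∑ _l : m, 2 * δ * |X i j| := by
    refine (Finset.abs_sum_le_sum_abs _ _).trans (Finset.sum_le_sum fun l _ => ?_)
    have h1 : |X i l * E l j| ≤ |X i j| * δ := by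
      rw [abs_mul]
      exact mul_le_mul (hmax (i, l)) (hA l j).le (abs_nonneg _) (abs_nonneg _)
    have h2 : |E i l * X l j| ≤ δ * |X i j| := by
      rw [abs_mul]
      exact mul_le_mul (hA i l).le (hmax (l, j)) (abs_nonneg _) hδ0.le
    linarith [abs_sub (X i l * E l j) (E i l * X l j)]
  rw [← hentry, abs_mul, Finset.sum_const, Finset.card_univ, nsmul_eq_mul] at hbound
  have h3 : (Fintype.card m : ℝ) * (2 * δ * |X i j|) = g / 2 * |X i j| := by
    rw [hδ]; field_simp; norm_num
  nlinarith [mul_le_mul_of_nonneg_right hgap hpos.le]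

end SSP

section Bordered

variable {ι κ : Type*} [Fintype ι] [DecidableEq ι]

/-- The symmetric extension of `P` with off-diagonal block `C` having the same rank as `P`. -/
noncomputable def bordered (P : Matrix ι ι ℝ) (C : Matrix ι κ ℝ) : Matrix (ι ⊕ κ) (ι ⊕ κ) ℝ :=
  Matrix.fromBlocks P C Cᵀ (Cᵀ * P⁻¹ * C)

theorem bordered_isSymm {P : Matrix ι ι ℝ} (hP : P.IsSymm) (C : Matrix ι κ ℝ) :
    (bordered P C).IsSymm := by
  refine Matrix.IsSymm.fromBlocks hP rfl ?_
  rw [Matrix.IsSymm, Matrix.transpose_mul, Matrix.transpose_mul, Matrix.transpose_transpose,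
    Matrix.transpose_nonsing_inv, hP.eq, Matrix.mul_assoc]

theorem exists_isospectral_parameters [Fintype κ] {ν : ι → ℝ} (hν : ∀ i, ν i ≠ 0)
    (hinj : Function.Injective ν) (B : Matrix ι ι ℝ) (E : Matrix ι κ ℝ)
    {Q : (ι → ℝ) × ℝ → Prop} (hQ : ∀ᶠ p in 𝓝 (ν, (0 : ℝ)), Q p) :
    ∃ θ : ι → ℝ, ∃ ε : ℝ, ε ≠ 0 ∧ Q (θ, ε) ∧ ∀ j,
      (ν j • (Matrix.diagonal θ + ε • B) -
        (Matrix.diagonal θ + ε • B) * (Matrix.diagonal θ + ε • B) -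
        (ε • E) * (ε • E)ᵀ).det = 0 := by
  let M : ι → (ι → ℝ) × ℝ → Matrix ι ι ℝ := fun j p =>
    ν j • (Matrix.diagonal p.1 + p.2 • B) -
      (Matrix.diagonal p.1 + p.2 • B) * (Matrix.diagonal p.1 + p.2 • B) -
      (p.2 • E) * (p.2 • E)ᵀ
  let F : (ι → ℝ) × ℝ → ι → ℝ := fun p j => (M j p).det
  have hF : ContDiff ℝ 1 F := by
    refine contDiff_pi.2 fun j => ?_
    have hentry : ∀ a b, ContDiff ℝ 1 fun p => M j p a b := by
      intro a b
      have hP : ∀ a b, ContDiff ℝ 1 fun p : (ι → ℝ) × ℝ =>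
          (Matrix.diagonal p.1 + p.2 • B) a b := by
        intro a b
        by_cases hab : a = b
        · subst hab
          simp only [Matrix.add_apply, Matrix.diagonal_apply_eq, Matrix.smul_apply]
          fun_prop
        · simp only [Matrix.add_apply, Matrix.diagonal_apply_ne _ hab, Matrix.smul_apply]
          fun_prop
      have hC : ∀ a b, ContDiff ℝ 1 fun p : (ι → ℝ) × ℝ => (p.2 • E) a b := fun a b =>
        contDiff_snd.mul contDiff_const
      exact ((contDiff_const.mul (hP a b)).sub
        (ContDiff.sum fun l _ => (hP a l).mul (hP l b))).sub
          (ContDiff.sum fun l _ => (hC a l).mul (hC b l))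
    simp only [F, Matrix.det_apply']
    exact ContDiff.sum fun σ _ => contDiff_const.mul (contDiff_prod fun i _ => hentry _ _)
  have hF' : HasStrictFDerivAt F (fderiv ℝ F (ν, 0)) (ν, 0) :=
    hF.contDiffAt.hasStrictFDerivAt one_ne_zero
  have hF0 : F (ν, 0) = 0 := by
    ext j
    simp only [F, M, zero_smul, add_zero, Matrix.zero_mul, sub_zero, Matrix.diagonal_mul_diagonal,
      ← Matrix.diagonal_smul, Matrix.diagonal_sub, Matrix.det_diagonal]
    exact Finset.prod_eq_zero (Finset.mem_univ j) (by simp)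
  have hpartial : ∀ v : ι → ℝ, ∀ j, fderiv ℝ F (ν, 0) (v, 0) j =
      -v j * ν j * ∏ i ∈ Finset.univ.erase j, (ν j * ν i - ν i * ν i) := by
    intro v j
    let h : ℝ → ℝ := fun s => -v j * (ν j + s * v j) *
      ∏ i ∈ Finset.univ.erase j, (ν j * (ν i + s * v i) - (ν i + s * v i) * (ν i + s * v i))
    have hline : HasDerivAt (fun s : ℝ => (ν + s • v, (0 : ℝ))) (v, 0) 0 := by
      refine HasDerivAt.prodMk ?_ (hasDerivAt_const _ _)
      simpa using ((hasDerivAt_id (0 : ℝ)).smul_const v).const_add ν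
    have h1 : HasDerivAt (fun s : ℝ => F (ν + s • v, 0)) (fderiv ℝ F (ν, 0) (v, 0)) 0 := by
      refine HasFDerivAt.comp_hasDerivAt (0 : ℝ) (l := F) ?_ hline
      simpa using hF'.hasFDerivAt
    have h2 : HasDerivAt (fun s : ℝ => F (ν + s • v, 0) j) (fderiv ℝ F (ν, 0) (v, 0) j) 0 :=
      hasDerivAt_pi.1 h1 j
    have hEq : (fun s : ℝ => F (ν + s • v, 0) j) = fun s => s * h s := by
      ext s
      simp only [F, M, zero_smul, add_zero, Matrix.zero_mul, sub_zero,
        Matrix.diagonal_mul_diagonal, ← Matrix.diagonal_smul, Matrix.diagonal_sub,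
        Matrix.det_diagonal, h]
      rw [← Finset.mul_prod_erase _ _ (Finset.mem_univ j)]
      simp only [Pi.add_apply, Pi.smul_apply, smul_eq_mul]
      ring
    have hd : DifferentiableAt ℝ h 0 := by fun_prop
    have h3 : HasDerivAt (fun s => s * h s) (h 0) 0 := by
      exact ((hasDerivAt_id' (0 : ℝ)).mul hd.hasDerivAt).congr_deriv (by simp)
    rw [hEq] at h2
    simpa [h] using h2.unique h3
  let G : (ι → ℝ) × ℝ → (ι → ℝ) × ℝ := fun p => (F p, p.2)
  have hG : HasStrictFDerivAt G
      ((fderiv ℝ F (ν, 0)).prod (ContinuousLinearMap.snd ℝ (ι → ℝ) ℝ)) (ν, 0) :=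
    hF'.prodMk hasStrictFDerivAt_snd
  have hGinj : Function.Injective
      ((fderiv ℝ F (ν, 0)).prod (ContinuousLinearMap.snd ℝ (ι → ℝ) ℝ)) := by
    rw [injective_iff_map_eq_zero]
    rintro ⟨v, e⟩ hve
    obtain ⟨hv, rfl⟩ : fderiv ℝ F (ν, 0) (v, e) = 0 ∧ e = 0 := by simpa using hve
    refine Prod.ext (funext fun j => ?_) rfl
    have hj := hpartial v j
    rw [hv, Pi.zero_apply, eq_comm, mul_eq_zero, mul_eq_zero, neg_eq_zero] at hj
    rcases hj with (hj | hj) | hj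
    · exact hj
    · exact absurd hj (hν j)
    · obtain ⟨i, hi, h0⟩ := Finset.prod_eq_zero_iff.1 hj
      rw [← sub_mul, mul_eq_zero, sub_eq_zero] at h0
      rcases h0 with h0 | h0
      · exact absurd (hinj h0).symm (Finset.ne_of_mem_erase hi)
      · exact absurd h0 (hν i)
  have hGsurj : ((fderiv ℝ F (ν, 0)).prod (ContinuousLinearMap.snd ℝ (ι → ℝ) ℝ)).range = ⊤ :=
    LinearMap.range_eq_top.2 (LinearMap.injective_iff_surjective.1 hGinj)
  have hmap := hG.map_nhds_eq_of_surj hGsurj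
  have hmem : G '' {p | Q p} ∈ 𝓝 ((0 : ι → ℝ), (0 : ℝ)) := by
    have : G (ν, 0) = (0, 0) := Prod.ext hF0 rfl
    rw [← this, ← hmap]
    exact image_mem_map hQ
  have hcont : Continuous fun ε : ℝ => ((0 : ι → ℝ), ε) := by fun_prop
  have hev : ∀ᶠ ε : ℝ in 𝓝[≠] 0, ((0 : ι → ℝ), ε) ∈ G '' {p | Q p} :=
    nhdsWithin_le_nhds (hcont.continuousAt.preimage_mem_nhds hmem)
  obtain ⟨ε, ⟨⟨θ, ε'⟩, hq, hg⟩, hε⟩ := (hev.and self_mem_nhdsWithin).exists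
  obtain ⟨hθ, rfl⟩ := Prod.mk.inj hg
  exact ⟨θ, ε', hε, hq, fun j => congrFun hθ j⟩

variable [DecidableEq κ]

theorem tendsto_bordered {ν : ι → ℝ} (hν : ∀ i, ν i ≠ 0) (B : Matrix ι ι ℝ)
    (E : Matrix ι κ ℝ) :
    Tendsto (fun p : (ι → ℝ) × ℝ => bordered (Matrix.diagonal p.1 + p.2 • B) (p.2 • E))
      (𝓝 (ν, 0)) (𝓝 (Matrix.diagonal (Sum.elim ν 0))) := by
  have hP : Continuous fun p : (ι → ℝ) × ℝ => Matrix.diagonal p.1 + p.2 • B := by fun_prop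
  have hC : Continuous fun p : (ι → ℝ) × ℝ => p.2 • E := by fun_prop
  have hdet : (Matrix.diagonal ν + (0 : ℝ) • B).det ≠ 0 := by
    simpa [Matrix.det_diagonal, Finset.prod_eq_zero_iff] using hν
  have hinv : ContinuousAt (fun p : (ι → ℝ) × ℝ => (Matrix.diagonal p.1 + p.2 • B)⁻¹) (ν, 0) := by
    refine ContinuousAt.comp (g := Inv.inv) (continuousAt_matrix_inv _ ?_) hP.continuousAt
    rw [Ring.inverse_eq_inv']
    exact continuousAt_inv₀ hdet
  have hW : ContinuousAt (fun p : (ι → ℝ) × ℝ =>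
      (p.2 • E)ᵀ * (Matrix.diagonal p.1 + p.2 • B)⁻¹ * (p.2 • E)) (ν, 0) := by
    have hg : Continuous fun q : Matrix ι κ ℝ × Matrix ι ι ℝ => q.1ᵀ * q.2 * q.1 := by fun_prop
    exact ContinuousAt.comp (x := (ν, (0 : ℝ)))
      (g := fun q : Matrix ι κ ℝ × Matrix ι ι ℝ => q.1ᵀ * q.2 * q.1)
      (f := fun p : (ι → ℝ) × ℝ => (p.2 • E, (Matrix.diagonal p.1 + p.2 • B)⁻¹))
      hg.continuousAt (hC.continuousAt.prodMk hinv)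
  have hblocks : Continuous fun q : (Matrix ι ι ℝ × Matrix ι κ ℝ) × Matrix κ κ ℝ =>
      Matrix.fromBlocks q.1.1 q.1.2 q.1.2ᵀ q.2 := by fun_prop
  have := ContinuousAt.comp (x := (ν, (0 : ℝ)))
    (g := fun q : (Matrix ι ι ℝ × Matrix ι κ ℝ) × Matrix κ κ ℝ =>
      Matrix.fromBlocks q.1.1 q.1.2 q.1.2ᵀ q.2)
    (f := fun p : (ι → ℝ) × ℝ => ((Matrix.diagonal p.1 + p.2 • B, p.2 • E),
      (p.2 • E)ᵀ * (Matrix.diagonal p.1 + p.2 • B)⁻¹ * (p.2 • E)))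
    hblocks.continuousAt ((hP.continuousAt.prodMk hC.continuousAt).prodMk hW)
  have hval : bordered (Matrix.diagonal ν + (0 : ℝ) • B) ((0 : ℝ) • E) =
      Matrix.diagonal (Sum.elim ν 0) := by
    rw [bordered]
    ext (i | i) (j | j) <;> simp [Matrix.diagonal_apply]
  rw [← hval]
  exact this

variable [Fintype κ]

theorem card_le_multOf_bordered_zero {P : Matrix ι ι ℝ} (hP : IsUnit P.det)
    (C : Matrix ι κ ℝ) : Fintype.card κ ≤ multOf (bordered P C) 0 := by
  have hker : ∀ w : κ → ℝ, Sum.elim (-(P⁻¹ *ᵥ (C *ᵥ w))) w ∈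
      LinearMap.ker (bordered P C - (0 : ℝ) • (1 : Matrix (ι ⊕ κ) (ι ⊕ κ) ℝ)).mulVecLin := by
    intro w
    rw [LinearMap.mem_ker, zero_smul, sub_zero, Matrix.mulVecLin_apply, bordered,
      Matrix.fromBlocks_mulVec]
    ext (i | i)
    · simp [Matrix.mulVec_neg, Matrix.mulVec_mulVec, ← Matrix.mul_assoc,
        Matrix.mul_nonsing_inv P hP]
    · simp [Matrix.mulVec_neg, Matrix.mulVec_mulVec, ← Matrix.mul_assoc]
  let L : (κ → ℝ) →ₗ[ℝ]
      LinearMap.ker (bordered P C - (0 : ℝ) • (1 : Matrix (ι ⊕ κ) (ι ⊕ κ) ℝ)).mulVecLin :=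
    { toFun := fun w => ⟨_, hker w⟩
      map_add' := fun w w' => by
        ext (i | i)
        · simp [Matrix.mulVec_add]; ring
        · simp
      map_smul' := fun c w => by
        ext (i | i)
        · simp [Matrix.mulVec_smul]
        · simp }
  have hL : Function.Injective L := fun w w' h => by
    ext i
    exact congrFun (congrArg Subtype.val h) (Sum.inr i)
  simpa [multOf] using LinearMap.finrank_le_finrank_of_injective hL

theorem one_le_multOf_bordered {P : Matrix ι ι ℝ} (hP : IsUnit P.det) {C : Matrix ι κ ℝ}
    {t : ℝ} (ht : (t • P - P * P - C * Cᵀ).det = 0) : 1 ≤ multOf (bordered P C) t := by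
  obtain ⟨x, hx0, hx⟩ := Matrix.exists_mulVec_eq_zero_iff.2 ht
  have hx' : P *ᵥ (P *ᵥ x) + C *ᵥ (Cᵀ *ᵥ x) = t • (P *ᵥ x) := by
    rw [Matrix.sub_mulVec, Matrix.sub_mulVec, Matrix.smul_mulVec, sub_sub, sub_eq_zero] at hx
    rw [hx, Matrix.mulVec_mulVec, Matrix.mulVec_mulVec]
  refine one_le_multOf (v := Sum.elim (P *ᵥ x) (Cᵀ *ᵥ x)) ?_ ?_
  · intro h
    refine hx0 (Matrix.eq_zero_of_mulVec_eq_zero hP.ne_zero ?_)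
    ext i
    exact congrFun h (Sum.inl i)
  · have h2 : Cᵀ *ᵥ (P *ᵥ x) + (Cᵀ * P⁻¹ * C) *ᵥ (Cᵀ *ᵥ x) = t • (Cᵀ *ᵥ x) := by
      have h3 : P⁻¹ *ᵥ (P *ᵥ x) = x := by
        rw [Matrix.mulVec_mulVec, Matrix.nonsing_inv_mul P hP, Matrix.one_mulVec]
      have h4 : P⁻¹ *ᵥ (P *ᵥ (P *ᵥ x)) = P *ᵥ x := by
        rw [Matrix.mulVec_mulVec, Matrix.nonsing_inv_mul P hP, Matrix.one_mulVec]
      have h5 := congrArg (fun y => Cᵀ *ᵥ (P⁻¹ *ᵥ y)) hx'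
      simp only [Matrix.mulVec_add, Matrix.mulVec_smul, h3, h4] at h5
      rw [← h5, ← Matrix.mulVec_mulVec, ← Matrix.mulVec_mulVec]
    rw [bordered, Matrix.fromBlocks_mulVec]
    ext (i | i)
    · simpa using congrFun hx' i
    · simpa using congrFun h2 i

end Bordered

section Cycle

/-- The adjacency matrix of the path `0 - 1 - ⋯ - (m - 1)`. -/
def pathMatrix (m : ℕ) : Matrix (Fin m) (Fin m) ℝ :=
  Matrix.of fun i j => if i.val + 1 = j.val ∨ j.val + 1 = i.val then 1 else 0

/-- The matrix whose two columns are the indicators of the last and of the first vertex. -/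
def endsMatrix (l : ℕ) : Matrix (Fin (l + 1)) (Fin 2) ℝ :=
  Matrix.of fun i c => if i = ![Fin.last l, 0] c then 1 else 0

theorem pathMatrix_isSymm (m : ℕ) : (pathMatrix m).IsSymm := by
  ext i j
  simp [pathMatrix, or_comm]

theorem endsMatrix_transpose_mul_mul_apply {l : ℕ} (N : Matrix (Fin (l + 1)) (Fin (l + 1)) ℝ) :
    ((endsMatrix l)ᵀ * N * endsMatrix l) 0 1 = N (Fin.last l) 0 := by
  have h0 : ∀ i, endsMatrix l i 0 = if i = Fin.last l then 1 else 0 := fun _ => rfl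
  have h1 : ∀ i, endsMatrix l i 1 = if i = 0 then 1 else 0 := fun _ => rfl
  simp [Matrix.mul_apply, h0, h1]

theorem inv_last_zero_ne_zero {l : ℕ} {θ : Fin (l + 1) → ℝ} {ε : ℝ} (hε : ε ≠ 0)
    (hdet : IsUnit (Matrix.diagonal θ + ε • pathMatrix (l + 1)).det) :
    (Matrix.diagonal θ + ε • pathMatrix (l + 1))⁻¹ (Fin.last l) 0 ≠ 0 := by
  have hPsymm : (Matrix.diagonal θ + ε • pathMatrix (l + 1)).IsSymm :=
    (Matrix.isSymm_diagonal θ).add ((pathMatrix_isSymm _).smul ε)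
  have hentry : ∀ i j, (Matrix.diagonal θ + ε • pathMatrix (l + 1)) i j =
      (if i = j then θ i else 0) +
        ε * (if i.val + 1 = j.val ∨ j.val + 1 = i.val then 1 else 0) := fun i j => by
    simp [pathMatrix, Matrix.diagonal_apply]
  set P := Matrix.diagonal θ + ε • pathMatrix (l + 1)
  intro h0
  have hPw : ∀ i, ∑ j, P i j * P⁻¹ j (Fin.last l) = (1 : Matrix _ _ ℝ) i (Fin.last l) := fun i => by
    rw [← Matrix.mul_apply, Matrix.mul_nonsing_inv P hdet]
  have hw : ∀ a : ℕ, ∀ ha : a < l + 1, P⁻¹ ⟨a, ha⟩ (Fin.last l) = 0 := by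
    intro a
    induction a using Nat.strong_induction_on with
    | _ a ih =>
      intro ha
      rcases a with _ | a
      · have hinv : (P⁻¹)ᵀ = P⁻¹ := by rw [Matrix.transpose_nonsing_inv, hPsymm.eq]
        rw [← hinv]
        exact h0
      · have hrow := hPw ⟨a, by lia⟩
        rw [Finset.sum_eq_single (⟨a + 1, ha⟩ : Fin (l + 1)), Matrix.one_apply_ne] at hrow
        · rw [hentry] at hrow
          simpa [Fin.ext_iff, hε] using hrow
        · simp only [ne_eq, Fin.ext_iff, Fin.val_last]
          lia
        · intro j _ hj
          rw [ne_eq, Fin.ext_iff] at hj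
          rcases Nat.lt_or_ge a j.val with hlt | hge
          · rw [hentry, if_neg (by rw [Fin.ext_iff]; simp only; lia),
              if_neg (by simp only at hj ⊢; lia)]
            simp
          · rw [ih j.val (by lia) j.isLt, mul_zero]
        · simp
  have hlast := hPw (Fin.last l)
  rw [Finset.sum_eq_zero fun j _ => by rw [hw j.val j.isLt, mul_zero], Matrix.one_apply_eq] at hlast
  exact zero_ne_one hlast

theorem cycleG_adj {n : ℕ} {i j : Fin n} : (cycleG n).Adj i j ↔
    i ≠ j ∧ ((i.val + 1) % n = j.val ∨ (j.val + 1) % n = i.val) :=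
  SimpleGraph.fromRel_adj _ _ _

theorem cycleG_adj_inr_inr {m : ℕ} {c c' : Fin 2} (h : c ≠ c') :
    (cycleG (m + 2)).Adj (finSumFinEquiv (Sum.inr c : Fin m ⊕ Fin 2))
      (finSumFinEquiv (Sum.inr c' : Fin m ⊕ Fin 2)) := by
  have hm : (m + 1) % (m + 2) = m + 1 := Nat.mod_eq_of_lt (by lia)
  obtain ⟨rfl, rfl⟩ | ⟨rfl, rfl⟩ : (c = 0 ∧ c' = 1) ∨ (c = 1 ∧ c' = 0) := by lia
  all_goals simp [cycleG_adj, hm, Fin.ext_iff]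

theorem InS.add_smul_one {m : Type*} [Fintype m] [DecidableEq m] {G : SimpleGraph m}
    {A : Matrix m m ℝ} (hA : InS G A) (c : ℝ) : InS G (A + c • (1 : Matrix m m ℝ)) :=
  ⟨hA.1.add (Matrix.isSymm_one.smul c), fun i j hij => by simpa [hij] using hA.2 i j hij⟩

theorem bordered_pathMatrix_ne_zero_iff {l : ℕ} {θ : Fin (l + 1) → ℝ} {ε : ℝ} (hε : ε ≠ 0)
    (hdet : IsUnit (Matrix.diagonal θ + ε • pathMatrix (l + 1)).det)
    {x y : Fin (l + 1) ⊕ Fin 2} (hxy : x ≠ y) :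
    bordered (Matrix.diagonal θ + ε • pathMatrix (l + 1)) (ε • endsMatrix l) x y ≠ 0 ↔
      (cycleG (l + 1 + 2)).Adj (finSumFinEquiv x) (finSumFinEquiv y) := by
  have hsymm := bordered_isSymm (((Matrix.isSymm_diagonal θ).add
    ((pathMatrix_isSymm (l + 1)).smul ε))) (ε • endsMatrix l)
  have hcorner : bordered (Matrix.diagonal θ + ε • pathMatrix (l + 1)) (ε • endsMatrix l)
      (Sum.inr 0) (Sum.inr 1) ≠ 0 := by
    have h1 : bordered (Matrix.diagonal θ + ε • pathMatrix (l + 1)) (ε • endsMatrix l)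
        (Sum.inr 0) (Sum.inr 1) =
        ε * (ε * (Matrix.diagonal θ + ε • pathMatrix (l + 1))⁻¹ (Fin.last l) 0) := by
      rw [bordered, Matrix.fromBlocks_apply₂₂, ← endsMatrix_transpose_mul_mul_apply
        (Matrix.diagonal θ + ε • pathMatrix (l + 1))⁻¹]
      simp [Matrix.transpose_smul, Matrix.smul_mul, Matrix.mul_smul]
    rw [h1]
    exact mul_ne_zero hε (mul_ne_zero hε (inv_last_zero_ne_zero hε hdet))
  have hedge : ∀ (i : Fin (l + 1)) (c : Fin 2),
      (bordered (Matrix.diagonal θ + ε • pathMatrix (l + 1)) (ε • endsMatrix l)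
        (Sum.inl i) (Sum.inr c) ≠ 0 ↔ (cycleG (l + 1 + 2)).Adj
          (finSumFinEquiv (Sum.inl i)) (finSumFinEquiv (Sum.inr c))) := by
    intro i c
    have hi : (i.val + 1) % (l + 1 + 2) = i.val + 1 := Nat.mod_eq_of_lt (by lia)
    have hentry : bordered (Matrix.diagonal θ + ε • pathMatrix (l + 1)) (ε • endsMatrix l)
        (Sum.inl i) (Sum.inr c) ≠ 0 ↔ i = ![Fin.last l, 0] c := by
      simp [bordered, endsMatrix, hε]
    rw [hentry, cycleG_adj]
    fin_cases c
    · have hm : (l + 1 + 1) % (l + 1 + 2) = l + 1 + 1 := Nat.mod_eq_of_lt (by lia)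
      simp [hi, hm, Fin.ext_iff]
      lia
    · have hm : (l + 1 + 1 + 1) % (l + 1 + 2) = 0 := Nat.mod_self _
      change i = 0 ↔ _ ≠ _ ∧ ((i.val + 1) % (l + 1 + 2) = l + 1 + 1 ∨
        (l + 1 + 1 + 1) % (l + 1 + 2) = i.val)
      rw [hi, hm, Fin.ext_iff, ne_eq, Fin.ext_iff]
      change i.val = 0 ↔ ¬ i.val = l + 1 + 1 ∧ _
      lia
  rcases x with i | c <;> rcases y with j | c'
  · have hij : i ≠ j := fun h => hxy (congrArg Sum.inl h)
    have hi : (i.val + 1) % (l + 1 + 2) = i.val + 1 := Nat.mod_eq_of_lt (by lia)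
    have hj : (j.val + 1) % (l + 1 + 2) = j.val + 1 := Nat.mod_eq_of_lt (by lia)
    have hentry : bordered (Matrix.diagonal θ + ε • pathMatrix (l + 1)) (ε • endsMatrix l)
        (Sum.inl i) (Sum.inl j) ≠ 0 ↔ i.val + 1 = j.val ∨ j.val + 1 = i.val := by
      simp [bordered, pathMatrix, hε, hij, -not_or]
    rw [hentry, cycleG_adj]
    simp [hi, hj, hij]
  · exact hedge i c'
  · rw [← hsymm.apply, SimpleGraph.adj_comm]
    exact hedge j c
  · have hcc : c ≠ c' := fun h => hxy (congrArg Sum.inr h)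
    obtain ⟨rfl, rfl⟩ | ⟨rfl, rfl⟩ : (c = 0 ∧ c' = 1) ∨ (c = 1 ∧ c' = 0) := by lia
    · exact iff_of_true hcorner (cycleG_adj_inr_inr zero_ne_one)
    · rw [← hsymm.apply, SimpleGraph.adj_comm]
      exact iff_of_true hcorner (cycleG_adj_inr_inr zero_ne_one)

theorem exists_cycle_matrix_of_injective {l : ℕ} {lam : Fin (l + 1 + 1) → ℝ}
    (hinj : Function.Injective lam) (k : Fin (l + 1 + 1)) :
    ∃ A : Matrix (Fin (l + 1 + 2)) (Fin (l + 1 + 2)) ℝ, InS (cycleG (l + 1 + 2)) A ∧ HasSSP A ∧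
      multOf A (lam k) = 2 ∧
      (∀ i, i ≠ k → multOf A (lam i) = 1) ∧
      ∀ t, (∀ i, t ≠ lam i) → multOf A t = 0 := by
  let ν : Fin (l + 1) → ℝ := fun j => lam (k.succAbove j) - lam k
  have hν0 : ∀ j, ν j ≠ 0 := fun j => sub_ne_zero.2 (hinj.ne (k.succAbove_ne j))
  have hνinj : Function.Injective ν := fun i j h =>
    Fin.succAbove_right_injective (hinj (sub_left_injective h))
  have hR : ∀ x y : Fin (l + 1) ⊕ Fin 2, x ≠ y → ¬ (x.isRight ∧ y.isRight) →
      Sum.elim ν (0 : Fin 2 → ℝ) x ≠ Sum.elim ν (0 : Fin 2 → ℝ) y := by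
    rintro (i | c) (j | c') hxy hr
    · exact hνinj.ne fun h => hxy (congrArg Sum.inl h)
    · exact hν0 i
    · exact (hν0 j).symm
    · simp at hr
  have hev := (tendsto_bordered hν0 (pathMatrix (l + 1)) (endsMatrix l)).eventually
    (eventually_commute_eq_zero hR)
  have hdetc : Continuous fun p : (Fin (l + 1) → ℝ) × ℝ =>
      (Matrix.diagonal p.1 + p.2 • pathMatrix (l + 1)).det :=
    Continuous.matrix_det (by fun_prop)
  have hdetev := hdetc.continuousAt.eventually_ne (x := (ν, (0 : ℝ))) (y := 0) (by
    simpa [Matrix.det_diagonal, Finset.prod_eq_zero_iff] using hν0)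
  obtain ⟨θ, ε, hε, ⟨hcomm, hdet⟩, hroot⟩ := exists_isospectral_parameters hν0 hνinj
    (pathMatrix (l + 1)) (endsMatrix l) (hev.and hdetev)
  have hunit := isUnit_iff_ne_zero.2 hdet
  have hpattern := @bordered_pathMatrix_ne_zero_iff l θ ε hε hunit
  have hsymm := bordered_isSymm (((Matrix.isSymm_diagonal θ).add
    ((pathMatrix_isSymm (l + 1)).smul ε))) (ε • endsMatrix l)
  have hzero := card_le_multOf_bordered_zero hunit (ε • endsMatrix l)
  have hone := fun j => one_le_multOf_bordered hunit (hroot j)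
  simp only at hcomm
  set A₀ := bordered (Matrix.diagonal θ + ε • pathMatrix (l + 1)) (ε • endsMatrix l)
  have hSSP : HasSSP A₀ := by
    intro X hX h1 h2 h3
    refine hcomm X (fun i => by simpa using congrFun (congrFun h2 i) i) ?_ (sub_eq_zero.1 h3)
    have hadj : ∀ x y, A₀ x y ≠ 0 → X x y = 0 := fun x y hA => by
      simpa [hA] using congrFun (congrFun h1 x) y
    rintro (i | c) (j | c') ⟨hx, hy⟩
    · simp at hx
    · simp at hx
    · simp at hy
    · by_cases hcc : c = c'
      · simpa [hcc] using congrFun (congrFun h2 (Sum.inr c')) (Sum.inr c')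
      · refine hadj _ _ ((hpattern fun h => hcc (Sum.inr_injective h)).2 ?_)
        exact cycleG_adj_inr_inr hcc
  let e : Fin (l + 1 + 2) ≃ Fin (l + 1) ⊕ Fin 2 := finSumFinEquiv.symm
  have hInS : InS (cycleG (l + 1 + 2)) (A₀.submatrix e e) := by
    refine ⟨hsymm.submatrix e, fun i j hij => ?_⟩
    simpa [e] using hpattern (e.injective.ne hij)
  have hmult : ∀ t, multOf (A₀.submatrix e e + lam k • 1) t = multOf A₀ (t - lam k) := fun t => by
    rw [multOf_add_smul_one, multOf_submatrix]
  have hlow : ∀ i, (if lam i = lam k then 2 else 1) ≤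
      multOf (A₀.submatrix e e + lam k • 1) (lam i) := by
    intro i
    rw [hmult]
    rcases k.eq_self_or_eq_succAbove i with rfl | ⟨j, rfl⟩
    · simpa using hzero
    · rw [if_neg (hinj.ne (k.succAbove_ne j))]
      exact hone j
  obtain ⟨hmem, hnot⟩ := multOf_eq_of_le_multOf (A := A₀.submatrix e e + lam k • 1)
    (s := Finset.univ.image lam) (r := fun t => if t = lam k then 2 else 1)
    (by simpa using hlow)
    (by
      rw [Finset.sum_image hinj.injOn, Fin.sum_univ_succAbove _ k]
      simp [hinj.eq_iff, Fin.succAbove_ne]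
      lia)
  refine ⟨_, hInS.add_smul_one (lam k), (hSSP.submatrix e).add_smul_one (lam k), ?_, ?_, ?_⟩
  · simpa using hmem (lam k) (by simp)
  · intro i hi
    simpa [hinj.eq_iff, hi] using hmem (lam i) (by simp)
  · intro t ht
    exact hnot t (by simpa using fun i => (ht i).symm)

end Cycle

/-- For `n ≥ 3`, any `n - 1` distinct reals `λ₁ < ⋯ < λ_{n-1}` and any index `k`,
there is an SSP matrix in `S(Cₙ)` whose eigenvalues are exactly the `λᵢ`, with
`λ_k` of multiplicity `2` and all other `λᵢ` simple. -/
theorem cycle_one_double_eigenvalue_SSP {n : ℕ} (hn : 3 ≤ n)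
    (lam : Fin (n - 1) → ℝ) (hmono : StrictMono lam) (k : Fin (n - 1)) :
    ∃ A : Matrix (Fin n) (Fin n) ℝ, InS (cycleG n) A ∧ HasSSP A ∧
      multOf A (lam k) = 2 ∧
      (∀ i, i ≠ k → multOf A (lam i) = 1) ∧
      ∀ t, (∀ i, t ≠ lam i) → multOf A t = 0 := by
  obtain ⟨l, rfl⟩ := Nat.exists_eq_add_of_le' hn
  exact exists_cycle_matrix_of_injective (l := l) hmono.injective k
end

section
/- Let A be an n×n real symmetric matrix with the Strong Spectral Property and graph G (so ij is an edge of G iff i ≠ j and a_ij ≠ 0). Then there exists Δ > 0, ε₀ > 0, and λ₀ ∈ ℝ such that for every ε with 0 < ε ≤ ε₀ and every λ ≥ λ₀ the following holds: for each (n+1)×(n+1) real symmetric matrix E with E ∘ I = O, E ∘ (A ⊕ [λ]) = O, and max(E) ≤ ε, there exists an (n+1)×(n+1) real symmetric matrix F = [f_ij] such that f_ij ≠ 0 only if i = j or ij is an edge of G, max(F) ≤ Δ·ε, and (A ⊕ [λ]) + E + F has the same spectrum (with multiplicities) as A ⊕ [λ]. -/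
open Matrix

/-- The block-diagonal matrix `A ⊕ [lam]`. -/
def addSimple {n : ℕ} (A : Matrix (Fin n) (Fin n) ℝ) (lam : ℝ) :
    Matrix (Fin n ⊕ Unit) (Fin n ⊕ Unit) ℝ :=
  Matrix.fromBlocks A 0 0 (Matrix.of fun _ _ => lam)

section LinearAlgebra

variable {m : Type*}

theorem multOf_similar [Fintype m] [DecidableEq m] (A P Q : Matrix m m ℝ) (hPQ : P * Q = 1) (t : ℝ) :
    multOf (P * A * Q) t = multOf A t := by
  have hrank (M : Matrix m m ℝ) :
      M.rank + Module.finrank ℝ (LinearMap.ker M.mulVecLin) = Fintype.card m := by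
    simpa [Matrix.rank] using LinearMap.finrank_range_add_finrank_ker M.mulVecLin
  have hdet : P.det * Q.det = 1 := by rw [← det_mul, hPQ, det_one]
  have hP : IsUnit P.det := IsUnit.of_mul_eq_one _ hdet
  have hQ : IsUnit Q.det := IsUnit.of_mul_eq_one _ (by rwa [mul_comm] at hdet)
  have hconj : P * A * Q - t • (1 : Matrix m m ℝ) = P * (A - t • (1 : Matrix m m ℝ)) * Q := by
    simp [mul_sub, sub_mul, hPQ]
  have h1 := hrank (P * A * Q - t • 1)
  have h2 := hrank (A - t • 1)
  rw [hconj, rank_mul_eq_left_of_isUnit_det _ _ hQ, rank_mul_eq_right_of_isUnit_det _ _ hP] at h1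
  unfold multOf
  rw [hconj]
  omega

/-- The symmetric matrices that vanish on the diagonal and on the pattern of `A`. -/
def offPattern (A : Matrix m m ℝ) : Submodule ℝ (Matrix m m ℝ) where
  carrier := {M | M.IsSymm ∧ ∀ i j, (i = j ∨ A i j ≠ 0) → M i j = 0}
  add_mem' := by
    rintro M N ⟨hM, hM'⟩ ⟨hN, hN'⟩
    exact ⟨hM.add hN, fun i j h => by simp [hM' i j h, hN' i j h]⟩
  zero_mem' := ⟨isSymm_zero, fun _ _ _ => rfl⟩
  smul_mem' := by
    rintro c M ⟨hM, hM'⟩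
    exact ⟨hM.smul c, fun i j h => by simp [hM' i j h]⟩

open Classical in
/-- Symmetrize a matrix and erase its diagonal and the entries on the pattern of `A`. -/
noncomputable def offProj (A : Matrix m m ℝ) (hA : A.IsSymm) :
    Matrix m m ℝ →ₗ[ℝ] offPattern A where
  toFun M := ⟨of fun i j => if i = j ∨ A i j ≠ 0 then 0 else (M i j + M j i) / 2, by
    refine ⟨?_, fun i j h => by simp only [of_apply, if_pos h]⟩
    ext i j
    simp only [transpose_apply, of_apply, hA.apply i j, eq_comm (a := j) (b := i), add_comm (M j i)]⟩
  map_add' M N := by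
    ext i j
    simp only [of_apply, Submodule.coe_add, Matrix.add_apply]
    split_ifs <;> ring
  map_smul' c M := by
    ext i j
    simp only [of_apply, Submodule.coe_smul, Matrix.smul_apply, RingHom.id_apply, smul_eq_mul]
    split_ifs <;> ring

variable {A : Matrix m m ℝ} (hA : A.IsSymm)

theorem offProj_apply_of_isSymm {M : Matrix m m ℝ} (hM : M.IsSymm) {i j : m}
    (hij : ¬(i = j ∨ A i j ≠ 0)) : (offProj A hA M : Matrix m m ℝ) i j = M i j := by
  simp only [offProj, LinearMap.coe_mk, AddHom.coe_mk, of_apply, if_neg hij, hM.apply i j]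
  ring

theorem offProj_transpose (M : Matrix m m ℝ) : offProj A hA Mᵀ = offProj A hA M := by
  ext i j
  simp [offProj, add_comm (M j i)]

theorem offProj_coe (M : offPattern A) : offProj A hA M = M := by
  ext i j
  by_cases hij : i = j ∨ A i j ≠ 0
  · rw [(offProj A hA M).2.2 i j hij, M.2.2 i j hij]
  · exact offProj_apply_of_isSymm hA M.2.1 hij

theorem offProj_single [DecidableEq m] {i j : m} (hij : i = j ∨ A i j ≠ 0) :
    offProj A hA (single i j 1) = 0 := by
  have hji : j = i ∨ A j i ≠ 0 := by rwa [hA.apply i j, eq_comm]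
  ext k l
  simp only [offProj, LinearMap.coe_mk, AddHom.coe_mk, of_apply, single_apply,
    ZeroMemClass.coe_zero, Matrix.zero_apply]
  grind

theorem offProj_self : offProj A hA A = 0 := by
  ext i j
  by_cases hij : i = j ∨ A i j ≠ 0
  · exact (offProj A hA A).2.2 i j hij
  · rw [offProj_apply_of_isSymm hA hA hij]
    push Not at hij
    exact hij.2

variable [Fintype m]

/-- The linear map `L ↦ [A, L - Lᵀ]`, followed by `offProj A`. -/
noncomputable def skewCommutator (A : Matrix m m ℝ) (hA : A.IsSymm) :
    Matrix m m ℝ →ₗ[ℝ] offPattern A :=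
  offProj A hA ∘ₗ (LinearMap.mulLeft ℝ A - LinearMap.mulRight ℝ A) ∘ₗ
    (LinearMap.id - (transposeLinearEquiv m m ℝ ℝ).toLinearMap)

theorem skewCommutator_apply (L : Matrix m m ℝ) :
    skewCommutator A hA L = offProj A hA (A * (L - Lᵀ) - (L - Lᵀ) * A) := rfl

theorem HasSSP.skewCommutator_surjective [DecidableEq m] (hssp : HasSSP A) :
    LinearMap.range (skewCommutator A hA) = ⊤ := by
  by_contra hne
  obtain ⟨f, hf0, hf⟩ := Submodule.exists_le_ker_of_lt_top _ (lt_top_iff_ne_top.2 hne)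
  set X : Matrix m m ℝ := of fun i j => f (offProj A hA (single j i 1)) with hX
  have htrace (M : Matrix m m ℝ) : f (offProj A hA M) = (X * M).trace := by
    have : f ∘ₗ offProj A hA = traceLinearMap m ℝ ℝ ∘ₗ LinearMap.mulLeft ℝ X :=
      ext_linearMap ℝ fun i j => LinearMap.ext_ring (by simp [hX, trace_mul_single])
    exact LinearMap.congr_fun this M
  have hXsymm : X.IsSymm := by
    ext i j
    simp only [hX, transpose_apply, of_apply]
    rw [← offProj_transpose, transpose_single]
  have hXoff {i j : m} (hij : i = j ∨ A i j ≠ 0) : X i j = 0 := by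
    simp only [hX, of_apply, offProj_single hA (hij.imp Eq.symm (hA.apply i j ▸ id)), map_zero]
  have hcomm : A * X - X * A = 0 := by
    set Y := A * X - X * A with hY
    have hYt : Yᵀ = -Y := by
      simp [hY, transpose_sub, transpose_mul, hA.eq, hXsymm.eq]
    have h0 : f (skewCommutator A hA Y) = 0 := hf (LinearMap.mem_range_self _ _)
    rw [skewCommutator_apply, htrace, hYt] at h0
    have h1 : (X * (A * (Y - -Y) - (Y - -Y) * A)).trace = 2 * (Yᵀ * Y).trace := by
      rw [hYt, sub_neg_eq_add, mul_sub, trace_sub, ← mul_assoc X, ← mul_assoc X,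
        trace_mul_comm (X * (Y + Y)) A, ← mul_assoc, ← trace_sub, ← sub_mul, ← two_smul ℝ Y,
        show X * A - A * X = -Y by rw [hY]; abel, mul_smul_comm, trace_smul, smul_eq_mul]
    have h2 : (Yᵀ * Y).trace = 0 := by linarith
    have h3 : (Yᴴ * Y).trace = 0 := by rwa [conjTranspose_eq_transpose_of_trivial]
    exact trace_conjTranspose_mul_self_eq_zero_iff.1 h3
  have hX0 : X = 0 := by
    refine hssp X hXsymm ?_ ?_ hcomm
    · ext i j
      by_cases h : A i j = 0
      · simp [h]
      · simp [hXoff (Or.inr h)]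
    · ext i j
      by_cases h : i = j
      · simp [hXoff (Or.inl h)]
      · simp [one_apply_ne h]
  refine hf0 (LinearMap.ext fun M => ?_)
  rw [← offProj_coe hA M, htrace, hX0]
  simp

theorem HasSSP.exists_skew_section [DecidableEq m] (hssp : HasSSP A) :
    ∃ k : offPattern A →ₗ[ℝ] Matrix m m ℝ, (∀ s, (k s)ᵀ = -k s) ∧
      ∀ s, offProj A hA (A * k s - k s * A) = s := by
  obtain ⟨g, hg⟩ := LinearMap.exists_rightInverse_of_surjective _
    (HasSSP.skewCommutator_surjective hA hssp)
  refine ⟨(LinearMap.id - (transposeLinearEquiv m m ℝ ℝ).toLinearMap) ∘ₗ g, fun s => ?_,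
    fun s => ?_⟩
  · simp
  · exact LinearMap.congr_fun hg s

end LinearAlgebra

section ImplicitFunction

variable {X Y : Type*} [NormedAddCommGroup X] [NormedSpace ℝ X] [FiniteDimensional ℝ X]
  [NormedAddCommGroup Y] [NormedSpace ℝ Y]

/-- A parametrized inverse function theorem with a Lipschitz bound uniform in the parameter. -/
theorem exists_uniform_lipschitz_solution {ψ : ℝ × X → X} {Θ : ℝ × X → Y} {Θ' : ℝ × X →L[ℝ] Y}
    (hψ : HasStrictFDerivAt ψ (ContinuousLinearMap.snd ℝ ℝ X) 0)
    (hψ0 : ∀ y, ψ (y, 0) = 0) (hΘ : HasStrictFDerivAt Θ Θ' 0) :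
    ∃ δ > 0, ∃ c > 0, ∀ y : ℝ, ‖y‖ < δ → ∀ p : X, ‖p‖ < δ →
      ∃ x, ψ (y, x) = p ∧ ‖Θ (y, x) - Θ (y, 0)‖ ≤ c * ‖p‖ := by
  have : CompleteSpace X := FiniteDimensional.complete ℝ X
  let Ψ : ℝ × X → ℝ × X := fun q => (q.1, ψ q)
  have hΨ : HasStrictFDerivAt Ψ
      (ContinuousLinearEquiv.refl ℝ (ℝ × X) : ℝ × X →L[ℝ] ℝ × X) 0 :=
    hasStrictFDerivAt_fst.prodMk hψ
  have hΨ0 (y : ℝ) : Ψ (y, 0) = (y, 0) := Prod.ext rfl (hψ0 y)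
  have hΨ00 : Ψ 0 = 0 := hΨ0 0
  obtain ⟨g, hg⟩ : ∃ g, g = hΨ.localInverse Ψ _ 0 := ⟨_, rfl⟩
  have hg0 : g 0 = 0 := by
    have := hΨ.localInverse_apply_image
    rwa [hΨ00, ← hg] at this
  have hgd := hΨ.to_localInverse
  rw [hΨ00] at hgd
  have hleft := hΨ.eventually_left_inverse
  have hright := hΨ.eventually_right_inverse
  rw [hΨ00] at hright
  rw [← hg] at hleft hright
  rw [← hg] at hgd
  have hΘg : HasStrictFDerivAt Θ Θ' (g 0) := by rwa [hg0]
  have hcomp := hΘg.comp 0 hgd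
  obtain ⟨K, s, hs, hK⟩ := hcomp.exists_lipschitzOnWith
  obtain ⟨δ, hδ, hball⟩ := Metric.eventually_nhds_iff.1
    ((hleft.and hright).and (Filter.eventually_mem_set.2 hs))
  refine ⟨δ, hδ, K + 1, by positivity, fun y hy p hp => ⟨(g (y, p)).2, ?_⟩⟩
  have hy0 : dist ((y, 0) : ℝ × X) 0 < δ := by
    rw [dist_zero_right, Prod.norm_def]
    exact max_lt hy (by simpa using hδ)
  have hyp : dist ((y, p) : ℝ × X) 0 < δ := by
    rw [dist_zero_right, Prod.norm_def]
    exact max_lt hy hp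
  have hsol : Ψ (g (y, p)) = (y, p) := (hball hyp).1.2
  have hpair : (y, (g (y, p)).2) = g (y, p) :=
    Prod.ext (congrArg Prod.fst hsol).symm rfl
  have hfix : g (y, 0) = (y, 0) := by
    have := (hball hy0).1.1
    rwa [hΨ0] at this
  refine ⟨by rw [hpair]; exact congrArg Prod.snd hsol, ?_⟩
  have hlip := hK.dist_le_mul _ (hball hyp).2 _ (hball hy0).2
  simp only [hfix, dist_eq_norm, Prod.mk_sub_mk, sub_self, sub_zero] at hlip
  rw [hpair]
  refine hlip.trans ?_
  have : ‖((0 : ℝ), p)‖ = ‖p‖ := by simp [Prod.norm_def]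
  rw [this]
  gcongr
  simp

end ImplicitFunction

section Householder

variable {m : Type*} [Fintype m] [DecidableEq m]

/-- The Householder reflection in the hyperplane orthogonal to `u`. -/
noncomputable def householder (u : m → ℝ) : Matrix m m ℝ :=
  1 - (2 * (u ⬝ᵥ u)⁻¹) • vecMulVec u u

theorem householder_mul_self {u : m → ℝ} (hu : u ⬝ᵥ u ≠ 0) :
    householder u * householder u = 1 := by
  have h : vecMulVec u u * vecMulVec u u = (u ⬝ᵥ u) • vecMulVec u u := by
    rw [vecMulVec_mul_vecMulVec, vecMulVec_smul]
  simp only [householder, sub_mul, mul_sub, one_mul, mul_one, smul_mul_assoc, mul_smul_comm, h,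
    smul_smul]
  rw [inv_mul_cancel_right₀ hu]
  module

theorem householder_conj_apply {N : Matrix m m ℝ} (hN : N.IsSymm) (u : m → ℝ) (i j : m) :
    (householder u * N * householder u) i j = N i j
      - 2 * (u ⬝ᵥ u)⁻¹ * (u i * (N *ᵥ u) j + (N *ᵥ u) i * u j)
      + 4 * (u ⬝ᵥ u)⁻¹ ^ 2 * (u ⬝ᵥ N *ᵥ u) * (u i * u j) := by
  have hvec : u ᵥ* N = N *ᵥ u := by rw [← mulVec_transpose, hN.eq]
  simp only [householder, sub_mul, mul_sub, one_mul, mul_one, smul_mul_assoc, mul_smul_comm,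
    mul_vecMulVec, vecMulVec_mul, hvec, Matrix.sub_apply,
    Matrix.smul_apply, vecMulVec_apply, smul_eq_mul, Pi.smul_apply,
    vecMulVec_mulVec, MulOpposite.smul_eq_mul_unop, MulOpposite.unop_op]
  rw [dotProduct_comm (N *ᵥ u) u]
  ring

end Householder

section Reflection

variable {ι : Type*} [Fintype ι]

/-- The reciprocal of the squared norm of `(y • z, 1)`. -/
noncomputable def invSq (y : ℝ) (z : ι → ℝ) : ℝ := (1 + y ^ 2 * (z ⬝ᵥ z))⁻¹

/-- The change, divided by `y`, in the leading block of `B ⊕ [y⁻¹]` after reflecting in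
the vector `(y • z, 1)`. -/
noncomputable def leadingCorrection (y : ℝ) (z : ι → ℝ) (B : Matrix ι ι ℝ) : Matrix ι ι ℝ :=
  of fun i j => (4 * invSq y z ^ 2 * (1 + y ^ 3 * (z ⬝ᵥ B *ᵥ z))) * (z i * z j)
    - 2 * invSq y z * y * (z i * (B *ᵥ z) j + (B *ᵥ z) i * z j)

/-- The change, divided by `y`, in half of the off-diagonal block of `B ⊕ [y⁻¹]` after
reflecting in the vector `(y • z, 1)`. -/
noncomputable def sideCorrection (y : ℝ) (z : ι → ℝ) (B : Matrix ι ι ℝ) : ι → ℝ :=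
  fun i => (2 * invSq y z ^ 2 * y ^ 2 * (z ⬝ᵥ B *ᵥ z)
    - (2 * invSq y z + 1) * invSq y z * y * (z ⬝ᵥ z)) * z i - invSq y z * (B *ᵥ z) i

/-- The change, divided by `y`, in the corner entry of `B ⊕ [y⁻¹]` after reflecting in
the vector `(y • z, 1)`. -/
noncomputable def cornerCorrection (y : ℝ) (z : ι → ℝ) (B : Matrix ι ι ℝ) : ℝ :=
  4 * invSq y z ^ 2 * (y * (z ⬝ᵥ B *ᵥ z) - z ⬝ᵥ z)

@[simp] theorem leadingCorrection_zero (y : ℝ) (B : Matrix ι ι ℝ) :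
    leadingCorrection y 0 B = 0 := by
  ext
  simp [leadingCorrection]

@[simp] theorem sideCorrection_zero (y : ℝ) (B : Matrix ι ι ℝ) : sideCorrection y 0 B = 0 := by
  ext
  simp [sideCorrection]

@[simp] theorem cornerCorrection_zero (y : ℝ) (B : Matrix ι ι ℝ) : cornerCorrection y 0 B = 0 := by
  simp [cornerCorrection]

theorem one_add_sq_mul_pos (y : ℝ) (z : ι → ℝ) : 0 < 1 + y ^ 2 * (z ⬝ᵥ z) := by
  have : 0 ≤ z ⬝ᵥ z := Finset.sum_nonneg fun i _ => mul_self_nonneg (z i)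
  positivity

theorem invSq_mul (y : ℝ) (z : ι → ℝ) : invSq y z * (1 + y ^ 2 * (z ⬝ᵥ z)) = 1 :=
  inv_mul_cancel₀ (one_add_sq_mul_pos y z).ne'

theorem leadingCorrection_isSymm (y : ℝ) (z : ι → ℝ) (B : Matrix ι ι ℝ) :
    (leadingCorrection y z B).IsSymm := by
  ext i j
  simp only [leadingCorrection, transpose_apply, of_apply]
  ring

theorem sumElim_dotProduct_self (y : ℝ) (z : ι → ℝ) :
    (Sum.elim (y • z) (1 : Unit → ℝ)) ⬝ᵥ (Sum.elim (y • z) (1 : Unit → ℝ)) =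
      1 + y ^ 2 * (z ⬝ᵥ z) := by
  simp
  ring

variable [DecidableEq ι]

theorem householder_conj_fromBlocks {y : ℝ} (hy : y ≠ 0) (z : ι → ℝ) {B : Matrix ι ι ℝ}
    (hB : B.IsSymm) :
    householder (Sum.elim (y • z) (1 : Unit → ℝ)) *
        fromBlocks B 0 0 (of fun _ _ => y⁻¹) * householder (Sum.elim (y • z) (1 : Unit → ℝ)) =
      fromBlocks (B + y • leadingCorrection y z B)
        (of fun i _ => 2 * (z i + y * sideCorrection y z B i))
        (of fun _ j => 2 * (z j + y * sideCorrection y z B j))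
        (of fun _ _ => y⁻¹ + y * cornerCorrection y z B) := by
  have hN : (fromBlocks B 0 0 (of fun _ _ : Unit => y⁻¹)).IsSymm :=
    hB.fromBlocks (by simp) (by ext; rfl)
  have hd := invSq_mul y z
  have hNu : fromBlocks B 0 0 (of fun _ _ : Unit => y⁻¹) *ᵥ Sum.elim (y • z) 1 =
      Sum.elim (y • B *ᵥ z) fun _ => y⁻¹ := by
    rw [fromBlocks_mulVec]
    ext (i | i) <;> simp [mulVec_smul, mulVec, dotProduct]
  have hβ : Sum.elim (y • z) (1 : Unit → ℝ) ⬝ᵥ Sum.elim (y • B *ᵥ z) (fun _ => y⁻¹) =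
      y ^ 2 * (z ⬝ᵥ B *ᵥ z) + y⁻¹ := by
    rw [sumElim_dotProduct_sumElim, smul_dotProduct, dotProduct_smul]
    simp only [smul_eq_mul, one_dotProduct, Finset.univ_unique, Finset.sum_singleton]
    ring
  ext a b
  rw [householder_conj_apply hN, hNu, hβ, sumElim_dotProduct_self, ← invSq]
  generalize hw : B *ᵥ z = w
  rcases a with i | a <;> rcases b with j | b <;>
    simp only [fromBlocks_apply₁₁, fromBlocks_apply₁₂, fromBlocks_apply₂₁, fromBlocks_apply₂₂,
      Sum.elim_inl, Sum.elim_inr, Pi.smul_apply, smul_eq_mul, of_apply, leadingCorrection,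
      sideCorrection, cornerCorrection, Matrix.add_apply, Matrix.smul_apply, Matrix.zero_apply,
      Pi.one_apply, hw] <;>
    generalize z ⬝ᵥ w = β at * <;> generalize z ⬝ᵥ z = q at * <;>
    generalize invSq y z = d at *
  · field_simp
    ring
  · field_simp
    linear_combination 2 * (1 + 2 * d) * z i * hd
  · field_simp
    linear_combination 2 * (1 + 2 * d) * z j * hd
  · field_simp
    linear_combination 4 * d * hd

end Reflection

section Smoothness

open scoped Matrix.Norms.Operator

variable {ι : Type*} [Fintype ι] {E : Type*} [NormedAddCommGroup E]
  [NormedSpace ℝ E] {k : WithTop ℕ∞}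

theorem contDiff_matrix_entry (i j : ι) : ContDiff ℝ k fun M : Matrix ι ι ℝ => M i j :=
  (entryLinearMap ℝ ℝ i j).toContinuousLinearMap.contDiff

theorem contDiff_matrix_of_entries [DecidableEq ι] {f : E → Matrix ι ι ℝ}
    (hf : ∀ i j, ContDiff ℝ k fun x => f x i j) : ContDiff ℝ k f := by
  have : f = fun x => ∑ i, ∑ j, f x i j • single i j (1 : ℝ) := by
    ext1 x
    conv_lhs => rw [matrix_eq_sum_single (f x)]
    simp
  rw [this]
  exact ContDiff.sum fun i _ => ContDiff.sum fun j _ => (hf i j).smul contDiff_const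

theorem contDiff_dotProduct_self :
    ContDiff ℝ k fun q : ℝ × (ι → ℝ) × Matrix ι ι ℝ => q.2.1 ⬝ᵥ q.2.1 := by
  unfold dotProduct
  fun_prop

theorem contDiff_mulVec_apply (i : ι) :
    ContDiff ℝ k fun q : ℝ × (ι → ℝ) × Matrix ι ι ℝ => (q.2.2 *ᵥ q.2.1) i := by
  refine ContDiff.sum fun j _ => ContDiff.mul ?_ (by fun_prop)
  exact (contDiff_matrix_entry i j).comp (contDiff_snd.comp contDiff_snd)

theorem contDiff_dotProduct_mulVec :
    ContDiff ℝ k fun q : ℝ × (ι → ℝ) × Matrix ι ι ℝ => q.2.1 ⬝ᵥ q.2.2 *ᵥ q.2.1 := by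
  have (i : ι) := contDiff_mulVec_apply (k := k) i
  unfold dotProduct
  fun_prop

theorem contDiff_invSq :
    ContDiff ℝ k fun q : ℝ × (ι → ℝ) × Matrix ι ι ℝ => invSq q.1 q.2.1 := by
  have := contDiff_dotProduct_self (ι := ι) (k := k)
  exact ContDiff.inv (by fun_prop) fun q => (one_add_sq_mul_pos _ _).ne'

theorem contDiff_leadingCorrection [DecidableEq ι] :
    ContDiff ℝ k fun q : ℝ × (ι → ℝ) × Matrix ι ι ℝ => leadingCorrection q.1 q.2.1 q.2.2 := by
  refine contDiff_matrix_of_entries fun i j => ?_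
  have (i : ι) := contDiff_mulVec_apply (k := k) i
  have := contDiff_dotProduct_mulVec (ι := ι) (k := k)
  have := contDiff_invSq (ι := ι) (k := k)
  simp only [leadingCorrection, of_apply]
  fun_prop

theorem contDiff_sideCorrection :
    ContDiff ℝ k fun q : ℝ × (ι → ℝ) × Matrix ι ι ℝ => sideCorrection q.1 q.2.1 q.2.2 := by
  refine contDiff_pi.2 fun i => ?_
  have := contDiff_dotProduct_self (ι := ι) (k := k)
  have := contDiff_mulVec_apply (k := k) i
  have := contDiff_dotProduct_mulVec (ι := ι) (k := k)
  have := contDiff_invSq (ι := ι) (k := k)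
  simp only [sideCorrection]
  fun_prop

theorem contDiff_cornerCorrection :
    ContDiff ℝ k fun q : ℝ × (ι → ℝ) × Matrix ι ι ℝ => cornerCorrection q.1 q.2.1 q.2.2 := by
  have := contDiff_dotProduct_self (ι := ι) (k := k)
  have := contDiff_dotProduct_mulVec (ι := ι) (k := k)
  have := contDiff_invSq (ι := ι) (k := k)
  simp only [cornerCorrection]
  fun_prop

variable [DecidableEq ι]

theorem hasStrictFDerivAt_exp_conj {X : Type*} [NormedAddCommGroup X] [NormedSpace ℝ X]
    (A : Matrix ι ι ℝ) (κ : X →L[ℝ] Matrix ι ι ℝ) :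
    ∃ D : X →L[ℝ] Matrix ι ι ℝ, (∀ s, D s = A * κ s - κ s * A) ∧
      HasStrictFDerivAt (fun s => NormedSpace.exp (-κ s) * A * NormedSpace.exp (κ s)) D 0 := by
  have hexp (κ : X →L[ℝ] Matrix ι ι ℝ) :
      HasStrictFDerivAt (fun s => NormedSpace.exp (κ s)) κ 0 := by
    have h : HasStrictFDerivAt (NormedSpace.exp) (1 : Matrix ι ι ℝ →L[ℝ] Matrix ι ι ℝ) (κ 0) := by
      rw [map_zero]
      exact hasStrictFDerivAt_exp_zero
    exact h.comp 0 κ.hasStrictFDerivAt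
  have h := ((hexp (-κ)).mul_const' A).mul' (hexp κ)
  refine ⟨_, fun s => ?_, h⟩
  change NormedSpace.exp (-κ 0) * A * κ s + -κ s * A * NormedSpace.exp (κ 0) = _
  simp [sub_eq_add_neg]

end Smoothness

section Solution

open scoped Matrix.Norms.Operator

variable {ι : Type*} [Fintype ι]

theorem abs_apply_le_linfty_opNorm (M : Matrix ι ι ℝ) (i j : ι) : |M i j| ≤ ‖M‖ := by
  rw [← Real.norm_eq_abs, ← coe_nnnorm, ← coe_nnnorm, NNReal.coe_le_coe, linfty_opNNNorm_def]
  exact (Finset.single_le_sum (f := fun j => ‖M i j‖₊) (fun _ _ => zero_le)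
    (Finset.mem_univ j)).trans
      (Finset.le_sup (f := fun i => ∑ j, ‖M i j‖₊) (Finset.mem_univ i))

theorem linfty_opNorm_le_card_mul {M : Matrix ι ι ℝ} {ε : ℝ} (hε : 0 ≤ ε)
    (hM : ∀ i j, |M i j| ≤ ε) : ‖M‖ ≤ Fintype.card ι * ε := by
  lift ε to NNReal using hε
  rw [← coe_nnnorm, ← NNReal.coe_natCast, ← NNReal.coe_mul, NNReal.coe_le_coe,
    linfty_opNNNorm_def]
  refine Finset.sup_le fun i _ => ?_
  rw [← nsmul_eq_mul, ← Finset.card_univ]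
  exact Finset.sum_le_card_nsmul _ _ _ fun j _ => hM i j

/-- A product of the parameter with a map vanishing at the origin has zero derivative there. -/
theorem hasStrictFDerivAt_fst_smul {X Y : Type*} [NormedAddCommGroup X] [NormedSpace ℝ X]
    [NormedAddCommGroup Y] [NormedSpace ℝ Y] {f : ℝ × X → Y} {f' : ℝ × X →L[ℝ] Y}
    (hf : HasStrictFDerivAt f f' 0) (hf0 : f 0 = 0) :
    HasStrictFDerivAt (fun q : ℝ × X => q.1 • f q) (0 : ℝ × X →L[ℝ] Y) 0 := by
  refine (HasStrictFDerivAt.smul hasStrictFDerivAt_fst hf).congr_fderiv ?_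
  ext <;> simp [hf0]

theorem hasStrictFDerivAt_fst_smul_comp {X Y : Type*} [NormedAddCommGroup X] [NormedSpace ℝ X]
    [NormedAddCommGroup Y] [NormedSpace ℝ Y] {C : ℝ → (ι → ℝ) → Matrix ι ι ℝ → Y}
    (hC : ContDiff ℝ 1 fun q : ℝ × (ι → ℝ) × Matrix ι ι ℝ => C q.1 q.2.1 q.2.2)
    {ζ : ℝ × X → ι → ℝ} {ζ' : ℝ × X →L[ℝ] ι → ℝ} (hζ : HasStrictFDerivAt ζ ζ' 0)
    {B : ℝ × X → Matrix ι ι ℝ} {B' : ℝ × X →L[ℝ] Matrix ι ι ℝ} (hB : HasStrictFDerivAt B B' 0)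
    (hC0 : C 0 (ζ 0) (B 0) = 0) :
    HasStrictFDerivAt (fun q : ℝ × X => q.1 • C q.1 (ζ q) (B q)) (0 : ℝ × X →L[ℝ] Y) 0 := by
  have hC' := hC.contDiffAt.hasStrictFDerivAt (x := ((0 : ℝ), ζ 0, B 0)) one_ne_zero
  exact hasStrictFDerivAt_fst_smul
    (HasStrictFDerivAt.comp (0 : ℝ × X) hC' (hasStrictFDerivAt_fst.prodMk (hζ.prodMk hB))) hC0

theorem hasStrictFDerivAt_add_fst_smul_comp {X Y : Type*} [NormedAddCommGroup X] [NormedSpace ℝ X]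
    [NormedAddCommGroup Y] [NormedSpace ℝ Y] {C : ℝ → (ι → ℝ) → Matrix ι ι ℝ → Y}
    (hC : ContDiff ℝ 1 fun q : ℝ × (ι → ℝ) × Matrix ι ι ℝ => C q.1 q.2.1 q.2.2)
    {ζ : ℝ × X → ι → ℝ} {ζ' : ℝ × X →L[ℝ] ι → ℝ} (hζ : HasStrictFDerivAt ζ ζ' 0)
    {B : ℝ × X → Matrix ι ι ℝ} {B' : ℝ × X →L[ℝ] Matrix ι ι ℝ} (hB : HasStrictFDerivAt B B' 0)
    (hC0 : C 0 (ζ 0) (B 0) = 0)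
    {g : ℝ × X → Y} {g' : ℝ × X →L[ℝ] Y} (hg : HasStrictFDerivAt g g' 0) :
    HasStrictFDerivAt (fun q : ℝ × X => g q + q.1 • C q.1 (ζ q) (B q)) g' 0 :=
  (hg.add (hasStrictFDerivAt_fst_smul_comp hC hζ hB hC0)).congr_fderiv (add_zero _)

variable [DecidableEq ι] {A : Matrix ι ι ℝ} (hA : A.IsSymm)

theorem HasSSP.exists_orthogonal_solution (hssp : HasSSP A) :
    ∃ δ > 0, ∃ c > 0, ∀ y : ℝ, ‖y‖ < δ → ∀ (b : ι → ℝ) (S : offPattern A), ‖(b, S)‖ < δ →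
      ∃ (z : ι → ℝ) (Q : Matrix ι ι ℝ), Qᵀ * Q = 1 ∧
        z + y • sideCorrection y z (Qᵀ * A * Q) = b ∧
        offProj A hA (Qᵀ * A * Q + y • leadingCorrection y z (Qᵀ * A * Q)) = S ∧
        ‖Qᵀ * A * Q + y • leadingCorrection y z (Qᵀ * A * Q) - A‖ ≤ c * ‖(b, S)‖ ∧
        |y * cornerCorrection y z (Qᵀ * A * Q)| ≤ c * ‖(b, S)‖ := by
  obtain ⟨k, hkT, hk⟩ := HasSSP.exists_skew_section hA hssp
  let κ : offPattern A →L[ℝ] Matrix ι ι ℝ := LinearMap.toContinuousLinearMap k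
  let P : Matrix ι ι ℝ →L[ℝ] offPattern A := LinearMap.toContinuousLinearMap (offProj A hA)
  let B : offPattern A → Matrix ι ι ℝ := fun s => NormedSpace.exp (-κ s) * A * NormedSpace.exp (κ s)
  have hB0 : B 0 = A := by simp [B]
  obtain ⟨D, hD, hBD⟩ := hasStrictFDerivAt_exp_conj A κ
  let X := (ι → ℝ) × offPattern A
  have hBq : HasStrictFDerivAt (fun q : ℝ × X => B q.2.2)
      (D ∘L ContinuousLinearMap.snd ℝ (ι → ℝ) (offPattern A) ∘L ContinuousLinearMap.snd ℝ ℝ X)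
      0 := by
    have h := (ContinuousLinearMap.snd ℝ (ι → ℝ) (offPattern A) ∘L
      ContinuousLinearMap.snd ℝ ℝ X).hasStrictFDerivAt (x := 0)
    exact HasStrictFDerivAt.comp (g := B) (0 : ℝ × X) hBD h
  have hz : HasStrictFDerivAt (fun q : ℝ × X => q.2.1)
      (ContinuousLinearMap.fst ℝ (ι → ℝ) (offPattern A) ∘L ContinuousLinearMap.snd ℝ ℝ X) 0 :=
    (ContinuousLinearMap.fst ℝ (ι → ℝ) (offPattern A) ∘L
      ContinuousLinearMap.snd ℝ ℝ X).hasStrictFDerivAt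
  have hlead := hasStrictFDerivAt_add_fst_smul_comp contDiff_leadingCorrection hz hBq
    (by simp) hBq
  have hside := hasStrictFDerivAt_add_fst_smul_comp contDiff_sideCorrection hz hBq (by simp) hz
  have hcorner := hasStrictFDerivAt_fst_smul_comp contDiff_cornerCorrection hz hBq (by simp)
  have hPlead := P.hasStrictFDerivAt.comp (0 : ℝ × X) hlead
  have hψ := (hside.prodMk hPlead).congr_fderiv
    (show _ = ContinuousLinearMap.snd ℝ ℝ X by
      refine ContinuousLinearMap.ext fun q => Prod.ext rfl ?_
      change P (D q.2.2) = q.2.2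
      rw [hD]
      exact hk q.2.2)
  have : FiniteDimensional ℝ X := inferInstanceAs (FiniteDimensional ℝ ((ι → ℝ) × offPattern A))
  obtain ⟨δ, hδ, c, hc, h⟩ := exists_uniform_lipschitz_solution hψ
    (fun y => by
      have : P A = 0 := offProj_self hA
      simp [hB0, this]) (hlead.prodMk hcorner)
  refine ⟨δ, hδ, c, hc, fun y hy b S hbS => ?_⟩
  obtain ⟨⟨z, s⟩, hsol, hbound⟩ := h y hy (b, S) hbS
  have hQT : (NormedSpace.exp (κ s))ᵀ = NormedSpace.exp (-κ s) := by
    rw [← exp_transpose]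
    exact congrArg _ (hkT s)
  refine ⟨z, NormedSpace.exp (κ s), ?_, ?_⟩
  · rw [hQT, exp_neg]
    exact nonsing_inv_mul _ ((isUnit_iff_isUnit_det _).1 (isUnit_exp _))
  rw [hQT]
  refine ⟨congrArg Prod.fst hsol, congrArg Prod.snd hsol, ?_, ?_⟩
  · have := (norm_fst_le _).trans hbound
    simpa [hB0] using this
  · have := (norm_snd_le _).trans hbound
    simpa using this

/-- An entrywise version of `HasSSP.exists_orthogonal_solution`. -/
theorem HasSSP.exists_orthogonal_solution_entrywise (hssp : HasSSP A) :
    ∃ δ > 0, ∃ c > 0, ∀ y : ℝ, |y| < δ → ∀ (b : ι → ℝ) (S : offPattern A) (ε : ℝ), 0 ≤ ε →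
      ε < δ → (∀ i, |b i| ≤ ε) → (∀ i j, |(S : Matrix ι ι ℝ) i j| ≤ ε) →
      ∃ (z : ι → ℝ) (Q : Matrix ι ι ℝ), Qᵀ * Q = 1 ∧
        (∀ i, z i + y * sideCorrection y z (Qᵀ * A * Q) i = b i) ∧
        offProj A hA (Qᵀ * A * Q + y • leadingCorrection y z (Qᵀ * A * Q)) = S ∧
        (∀ i j, |(Qᵀ * A * Q + y • leadingCorrection y z (Qᵀ * A * Q)) i j - A i j| ≤ c * ε) ∧
        |y * cornerCorrection y z (Qᵀ * A * Q)| ≤ c * ε := by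
  obtain ⟨δ, hδ, c, hc, h⟩ := HasSSP.exists_orthogonal_solution hA hssp
  set N : ℝ := Fintype.card ι + 1
  have hN : 1 ≤ N := by simp [N]
  have hN0 : 0 < N := by linarith
  refine ⟨δ / N, by positivity, c * N, by positivity, fun y hy b S ε hε hεδ hb hS => ?_⟩
  have hnorm : ‖(b, S)‖ ≤ N * ε := by
    refine max_le ?_ ?_
    · refine (pi_norm_le_iff_of_nonneg (by positivity)).2 fun i => (hb i).trans ?_
      nlinarith
    · refine (linfty_opNorm_le_card_mul hε hS).trans ?_
      simp only [N]
      linarith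
  have hεN : N * ε < δ := by rwa [mul_comm, ← lt_div_iff₀ hN0]
  obtain ⟨z, Q, hQ, hside, hlead, hlead_le, hcorner_le⟩ :=
    h y (hy.trans_le (div_le_self hδ.le hN)) b S (hnorm.trans_lt hεN)
  have hcN : c * ‖(b, S)‖ ≤ c * N * ε := by
    rw [mul_assoc]
    gcongr
  exact ⟨z, Q, hQ, fun i => congrFun hside i, hlead,
    fun i j => (abs_apply_le_linfty_opNorm _ i j).trans (hlead_le.trans hcN),
    hcorner_le.trans hcN⟩

end Solution

theorem multOf_conj_addSimple {n : ℕ} (A Q : Matrix (Fin n) (Fin n) ℝ) (hQ : Qᵀ * Q = 1)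
    {H : Matrix (Fin n ⊕ Unit) (Fin n ⊕ Unit) ℝ} (hH : H * H = 1) (lam t : ℝ) :
    multOf (H * addSimple (Qᵀ * A * Q) lam * H) t = multOf (addSimple A lam) t := by
  have hblock : addSimple (Qᵀ * A * Q) lam =
      fromBlocks Qᵀ 0 0 (1 : Matrix Unit Unit ℝ) * addSimple A lam *
        fromBlocks Q 0 0 (1 : Matrix Unit Unit ℝ) := by
    simp [addSimple, fromBlocks_multiply]
  have hinv : fromBlocks Qᵀ 0 0 (1 : Matrix Unit Unit ℝ) *
      fromBlocks Q 0 0 (1 : Matrix Unit Unit ℝ) = 1 := by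
    simp [fromBlocks_multiply, hQ]
  have := multOf_similar (addSimple A lam) (H * fromBlocks Qᵀ 0 0 (1 : Matrix Unit Unit ℝ))
    (fromBlocks Q 0 0 (1 : Matrix Unit Unit ℝ) * H)
    (by rw [mul_assoc, ← mul_assoc _ _ H, hinv, one_mul, hH]) t
  rw [← this, hblock]
  simp only [mul_assoc]

/-- If `A` is symmetric with the SSP, then there are `Δ > 0`, `ε₀ > 0` and `λ₀`
such that for all `0 < ε ≤ ε₀` and `λ ≥ λ₀`: every symmetric perturbation `E`
with zero diagonal, supported off the pattern of `A ⊕ [λ]`, and entries of size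
at most `ε`, can be corrected by a symmetric `F` supported on the diagonal and
the edges of the graph of `A`, with entries at most `Δ·ε`, so that
`A ⊕ [λ] + E + F` is cospectral with `A ⊕ [λ]`. -/
theorem epsilon_bound_perturbation {n : ℕ} (A : Matrix (Fin n) (Fin n) ℝ)
    (hsym : A.IsSymm) (hssp : HasSSP A) :
    ∃ Δ : ℝ, 0 < Δ ∧ ∃ ε₀ : ℝ, 0 < ε₀ ∧ ∃ lam₀ : ℝ,
      ∀ ε : ℝ, 0 < ε → ε ≤ ε₀ → ∀ lam : ℝ, lam₀ ≤ lam →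
        ∀ E : Matrix (Fin n ⊕ Unit) (Fin n ⊕ Unit) ℝ, E.IsSymm →
          Matrix.hadamard (1 : Matrix (Fin n ⊕ Unit) (Fin n ⊕ Unit) ℝ) E = 0 →
          Matrix.hadamard (addSimple A lam) E = 0 →
          (∀ u v, |E u v| ≤ ε) →
          ∃ F : Matrix (Fin n ⊕ Unit) (Fin n ⊕ Unit) ℝ, F.IsSymm ∧
            (∀ u v, F u v ≠ 0 →
              u = v ∨ ∃ i j : Fin n, u = Sum.inl i ∧ v = Sum.inl j ∧ i ≠ j ∧ A i j ≠ 0) ∧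
            (∀ u v, |F u v| ≤ Δ * ε) ∧
            ∀ t : ℝ, multOf (addSimple A lam + E + F) t = multOf (addSimple A lam) t := by
  obtain ⟨δ, hδ, c, hc, h⟩ := HasSSP.exists_orthogonal_solution_entrywise hsym hssp
  refine ⟨c + 1, by positivity, δ / 2, by positivity, 2 / δ, ?_⟩
  intro ε hε hεδ lam hlam E hE hE1 hEA hEε
  have hlam0 : 0 < lam := (by positivity : 0 < 2 / δ).trans_le hlam
  have hy : |lam⁻¹| < δ := by
    rw [abs_of_pos (by positivity)]
    refine (inv_anti₀ (by positivity) hlam).trans_lt ?_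
    rw [inv_div]
    linarith
  have hdiag (u) : E u u = 0 := by simpa using congrFun (congrFun hE1 u) u
  have hoff {u v} (huv : addSimple A lam u v ≠ 0) : E u v = 0 :=
    (mul_eq_zero.1 (congrFun (congrFun hEA u) v)).resolve_left huv
  let S : offPattern A := ⟨E.toBlocks₁₁, by
    refine ⟨ext fun i j => hE.apply _ _, ?_⟩
    rintro i j (rfl | hij)
    · exact hdiag _
    · exact hoff (u := Sum.inl i) (v := Sum.inl j) hij⟩
  obtain ⟨z, Q, hQ, hside, hlead, hlead_le, hcorner_le⟩ :=
    h lam⁻¹ hy (fun i => E (Sum.inl i) (Sum.inr ()) / 2) S ε hε.le (by linarith)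
      (fun i => by
        rw [abs_div, abs_two]
        linarith [hEε (Sum.inl i) (Sum.inr ()), abs_nonneg (E (Sum.inl i) (Sum.inr ()))])
      (fun i j => hEε _ _)
  have hB : (Qᵀ * A * Q).IsSymm := by
    simp [IsSymm, transpose_mul, hsym.eq, mul_assoc]
  have hH := householder_mul_self (u := Sum.elim (lam⁻¹ • z) (1 : Unit → ℝ))
    (by rw [sumElim_dotProduct_self]; exact (one_add_sq_mul_pos _ _).ne')
  have hmult := multOf_conj_addSimple A Q hQ hH lam
  have hM := householder_conj_fromBlocks (inv_ne_zero hlam0.ne') z hB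
  rw [inv_inv] at hM
  rw [addSimple, hM] at hmult
  set B := Qᵀ * A * Q
  set L := B + lam⁻¹ • leadingCorrection lam⁻¹ z B
  have hLsymm : L.IsSymm := hB.add ((leadingCorrection_isSymm _ _ _).smul _)
  have hLE {i j} (hij : ¬(i = j ∨ A i j ≠ 0)) : L i j = E (Sum.inl i) (Sum.inl j) := by
    rw [← offProj_apply_of_isSymm hsym hLsymm hij, hlead]
    rfl
  have hF : addSimple A lam + E + fromBlocks (L - A - E.toBlocks₁₁) 0 0
        (of fun _ _ => lam⁻¹ * cornerCorrection lam⁻¹ z B) =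
      fromBlocks L (of fun i _ => 2 * (z i + lam⁻¹ * sideCorrection lam⁻¹ z B i))
        (of fun _ j => 2 * (z j + lam⁻¹ * sideCorrection lam⁻¹ z B j))
        (of fun _ _ => lam + lam⁻¹ * cornerCorrection lam⁻¹ z B) := by
    ext (i | i) (j | j)
    · simp [addSimple, toBlocks₁₁]
    · simp [addSimple, hside]
      ring
    · simp [addSimple, hside, hE.apply (Sum.inl j) (Sum.inr ())]
      ring
    · simp [addSimple, hdiag]
  refine ⟨fromBlocks (L - A - E.toBlocks₁₁) 0 0
    (of fun _ _ => lam⁻¹ * cornerCorrection lam⁻¹ z B), ?_, ?_, ?_, fun t => hF ▸ hmult t⟩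
  · refine IsSymm.fromBlocks ((hLsymm.sub hsym).sub S.2.1) (by simp) ?_
    ext
    rfl
  · rintro (i | i) (j | j) huv
    · by_cases hij : i = j
      · exact Or.inl (congrArg _ hij)
      · refine Or.inr ⟨i, j, rfl, rfl, hij, fun hA => huv ?_⟩
        simp [hLE (show ¬(i = j ∨ A i j ≠ 0) by simp [hij, hA]), hA, toBlocks₁₁]
    · exact absurd rfl huv
    · exact absurd rfl huv
    · exact Or.inl rfl
  · have hnonneg : 0 ≤ (c + 1) * ε := by positivity
    rintro (i | i) (j | j)
    · refine (abs_sub _ _).trans ((add_le_add (hlead_le i j) (hEε _ _)).trans_eq ?_)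
      ring
    · simpa using hnonneg
    · simpa using hnonneg
    · change |lam⁻¹ * cornerCorrection lam⁻¹ z B| ≤ _
      linarith
end
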